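/- There exists a unique point a* ∈ K_a minimizing the function a ↦ −∑_x p_x log a_x over K_a (with the convention −log 0 = +∞). -/

import Mathlib

noncomputable section

open Finset

variable {X Y J : Type*}

/-- `f(u,v) = u·log u − u·log v` with the conventions `f(0,v) = 0` and `f(u,0) = +∞` for `u > 0`,
taking values in the extended reals. -/
def fdiv (u v : ℝ) : EReal :=
  if u = 0 then 0
  else if v = 0 then (⊤ : EReal)
  else ((u * Real.log u - u * Real.log v : ℝ) : EReal)

/-- Marginal `p_x := ∑_y p_{x,y}`. -/
def margX [Fintype Y] (p : X → Y → ℝ) (x : X) : ℝ := ∑ y, p x y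

/-- Marginal `p^y := ∑_x p_{x,y}`. -/
def margY [Fintype X] (p : X → Y → ℝ) (y : Y) : ℝ := ∑ x, p x y

/-- The polytope `K_q`: `q_{j|x} ≥ 0`, `∑_{j∋x} q_{j|x} = 1` for every `x`,
and `q_{j|x} = 0` whenever `x ∉ j`. -/
def Kq [Fintype J] [DecidableEq X] (S : J → Finset X) : Set (J → X → ℝ) :=
  {q | (∀ j x, 0 ≤ q j x) ∧ (∀ x, (∑ j, if x ∈ S j then q j x else 0) = 1) ∧
    (∀ j x, x ∉ S j → q j x = 0)}

/-- The polytope `K_r`: `r_{j|y} ≥ 0` and `∑_j r_{j|y} = 1` for every `y`. -/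
def Kr (J Y : Type*) [Fintype J] : Set (J → Y → ℝ) :=
  {r | (∀ j y, 0 ≤ r j y) ∧ ∀ y, (∑ j, r j y) = 1}

/-- `φ(q,r) := ∑_{x,y,j} p_{x,y} · f(q_{j|x}, r_{j|y})`, extended-real valued. -/
def phi [Fintype X] [Fintype Y] [Fintype J] (p : X → Y → ℝ)
    (q : J → X → ℝ) (r : J → Y → ℝ) : EReal :=
  ∑ x, ∑ y, ∑ j, (p x y : EReal) * fdiv (q j x) (r j y)

/-- `δ(q,q') := ∑_x p_x ∑_{j∋x} f(q_{j|x}, q'_{j|x})`, extended-real valued. -/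
def delta [Fintype X] [Fintype Y] [Fintype J] [DecidableEq X] (p : X → Y → ℝ)
    (S : J → Finset X) (q q' : J → X → ℝ) : EReal :=
  ∑ x, (margX p x : EReal) * ∑ j, (if x ∈ S j then fdiv (q j x) (q' j x) else 0)

/-- `R_{j|y}(q) := ∑_{x∈j} p_{x|y} q_{j|x}`. -/
def Rmap [Fintype X] [Fintype Y] [DecidableEq X] (p : X → Y → ℝ) (S : J → Finset X)
    (q : J → X → ℝ) : J → Y → ℝ :=
  fun j y => ∑ x, if x ∈ S j then (p x y / margY p y) * q j x else 0

/-- `A_x(r) := ∑_{j∋x} ∏_y (r_{j|y})^{p^{y|x}}` (real powers, with `0^0 = 1`). -/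
def Afun [Fintype Y] [Fintype J] [DecidableEq X] (p : X → Y → ℝ) (S : J → Finset X)
    (r : J → Y → ℝ) (x : X) : ℝ :=
  ∑ j, if x ∈ S j then (∏ y, r j y ^ (p x y / margX p x)) else 0

/-- `Q_{j|x}(r) := (∏_y (r_{j|y})^{p^{y|x}}) / A_x(r)` if `x ∈ j`, and `0` otherwise. -/
def Qmap [Fintype Y] [Fintype J] [DecidableEq X] (p : X → Y → ℝ) (S : J → Finset X)
    (r : J → Y → ℝ) : J → X → ℝ :=
  fun j x => if x ∈ S j then (∏ y, r j y ^ (p x y / margX p x)) / Afun p S r x else 0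

open Classical in
/-- `φ_r(r) := −∑_x p_x log A_x(r)`, equal to `+∞` if `A_x(r) = 0` for some `x`. -/
def phiR [Fintype X] [Fintype Y] [Fintype J] [DecidableEq X] (p : X → Y → ℝ)
    (S : J → Finset X) (r : J → Y → ℝ) : EReal :=
  if ∃ x, Afun p S r x = 0 then ⊤
  else (((- ∑ x, margX p x * Real.log (Afun p S r x)) : ℝ) : EReal)

/-- The explicit real-valued formula for `φ_q`:
`∑_x p_x ∑_{j∋x} q_{j|x} log q_{j|x} − ∑_y p^y ∑_j R_{j|y}(q) log R_{j|y}(q)`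
(with the convention `0·log 0 = 0`, automatic since `Real.log 0 = 0`). -/
def phiQexp [Fintype X] [Fintype Y] [Fintype J] [DecidableEq X] (p : X → Y → ℝ)
    (S : J → Finset X) (q : J → X → ℝ) : ℝ :=
  (∑ x, margX p x * ∑ j, if x ∈ S j then q j x * Real.log (q j x) else 0)
    - ∑ y, margY p y * ∑ j, Rmap p S q j y * Real.log (Rmap p S q j y)

/-- The convex corner `K_a := {a : 0 ≤ a_x ≤ A_x(r) (∀x) for some r ∈ K_r}`. -/
def Ka [Fintype X] [Fintype Y] [Fintype J] [DecidableEq X] (p : X → Y → ℝ)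
    (S : J → Finset X) : Set (X → ℝ) :=
  {a | ∃ r ∈ Kr J Y, ∀ x, 0 ≤ a x ∧ a x ≤ Afun p S r x}

open Classical in
/-- `φ_a(a) := −∑_x p_x log a_x`, equal to `+∞` if `a_x = 0` for some `x`. -/
def phiA [Fintype X] [Fintype Y] (p : X → Y → ℝ) (a : X → ℝ) : EReal :=
  if ∃ x, a x = 0 then ⊤
  else (((- ∑ x, margX p x * Real.log (a x)) : ℝ) : EReal)

/-- Midpoint concavity of the weighted geometric mean. -/
lemma prod_rpow_add_le_two_mul_midpoint [Fintype Y] {w r s : Y → ℝ} (hw : ∀ y, 0 ≤ w y)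
    (hw1 : ∑ y, w y = 1) (hr : ∀ y, 0 ≤ r y) (hs : ∀ y, 0 ≤ s y) :
    (∏ y, r y ^ w y) + ∏ y, s y ^ w y ≤ 2 * ∏ y, ((r y + s y) / 2) ^ w y := by
  set t : Y → ℝ := fun y => (r y + s y) / 2 with ht
  have ht0 : ∀ y, 0 ≤ t y := fun y => by have := hr y; have := hs y; simp only [ht]; positivity
  have key : ∀ u : Y → ℝ, (∀ y, 0 ≤ u y) → (∀ y, t y = 0 → u y = 0) →
      ∏ y, u y ^ w y ≤ (∑ y, w y * (u y / t y)) * ∏ y, t y ^ w y := by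
    intro u hu hut
    have hfac : ∏ y, u y ^ w y = (∏ y, (u y / t y) ^ w y) * ∏ y, t y ^ w y := by
      rw [← prod_mul_distrib]
      refine prod_congr rfl fun y _ => ?_
      rw [← Real.mul_rpow (div_nonneg (hu y) (ht0 y)) (ht0 y), div_mul_cancel_of_imp (hut y)]
    rw [hfac]
    refine mul_le_mul_of_nonneg_right ?_ (prod_nonneg fun y _ => Real.rpow_nonneg (ht0 y) _)
    exact Real.geom_mean_le_arith_mean_weighted _ _ _ (fun y _ => hw y) hw1
      (fun y _ => div_nonneg (hu y) (ht0 y))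
  have h1 := key r hr fun y h => by have := hr y; have := hs y; simp only [ht] at h; linarith
  have h2 := key s hs fun y h => by have := hr y; have := hs y; simp only [ht] at h; linarith
  refine (add_le_add h1 h2).trans ?_
  rw [← add_mul, ← sum_add_distrib]
  refine mul_le_mul_of_nonneg_right ?_ (prod_nonneg fun y _ => Real.rpow_nonneg (ht0 y) _)
  calc ∑ y, (w y * (r y / t y) + w y * (s y / t y)) ≤ ∑ y, w y * 2 := by
        refine sum_le_sum fun y _ => ?_
        rw [← mul_add, ← add_div]
        refine mul_le_mul_of_nonneg_left ?_ (hw y)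
        exact div_le_of_le_mul₀ (ht0 y) (by norm_num) (by simp only [ht]; linarith)
    _ = 2 := by rw [← sum_mul, hw1, one_mul]

section Simplex

variable [Fintype J]

lemma isCompact_Kr : IsCompact (Kr J Y) := by
  have hbox : IsCompact (Set.Icc (0 : J → Y → ℝ) 1) := isCompact_Icc
  refine hbox.of_isClosed_subset ?_ ?_
  · have h : Kr J Y = (⋂ j, ⋂ y, {r : J → Y → ℝ | 0 ≤ r j y}) ∩
        ⋂ y, {r : J → Y → ℝ | ∑ j, r j y = 1} := by
      ext r; simp [Kr]
    rw [h]
    refine IsClosed.inter (isClosed_iInter fun j => isClosed_iInter fun y => ?_)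
      (isClosed_iInter fun y => ?_)
    · exact isClosed_le continuous_const (continuous_apply_apply j y)
    · exact isClosed_eq (continuous_finsetSum _ fun j _ => continuous_apply_apply j y)
        continuous_const
  · rintro r ⟨h0, h1⟩
    refine ⟨fun j y => h0 j y, fun j y => ?_⟩
    rw [Pi.one_apply, Pi.one_apply, ← h1 y]
    exact single_le_sum (f := fun j => r j y) (fun i _ => h0 i y) (mem_univ j)

lemma midpoint_mem_Kr {r s : J → Y → ℝ} (hr : r ∈ Kr J Y) (hs : s ∈ Kr J Y) :
    (fun j y => (r j y + s j y) / 2) ∈ Kr J Y := by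
  refine ⟨fun j y => ?_, fun y => ?_⟩
  · have := hr.1 j y
    have := hs.1 j y
    positivity
  · rw [← sum_div, sum_add_distrib, hr.2, hs.2]
    norm_num

lemma uniform_mem_Kr [Nonempty J] : (fun _ _ => (Fintype.card J : ℝ)⁻¹) ∈ Kr J Y :=
  ⟨fun _ _ => by positivity, fun _ => by simp⟩

end Simplex

section Corner

variable [Fintype Y] [Fintype J] [DecidableEq X] {p : X → Y → ℝ} {S : J → Finset X}

lemma Afun_midpoint (hp : ∀ x y, 0 ≤ p x y) (hpx : ∀ x, 0 < margX p x)
    {r s : J → Y → ℝ} (hr : ∀ j y, 0 ≤ r j y) (hs : ∀ j y, 0 ≤ s j y) (x : X) :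
    Afun p S r x + Afun p S s x ≤ 2 * Afun p S (fun j y => (r j y + s j y) / 2) x := by
  unfold Afun
  rw [← sum_add_distrib, mul_sum]
  refine sum_le_sum fun j _ => ?_
  split_ifs
  · refine prod_rpow_add_le_two_mul_midpoint (fun y => div_nonneg (hp x y) (hpx x).le) ?_
      (hr j) (hs j)
    rw [← sum_div]
    exact div_self (hpx x).ne'
  · simp

lemma continuous_Afun (hp : ∀ x y, 0 ≤ p x y) (hpx : ∀ x, 0 < margX p x) (x : X) :
    Continuous fun r : J → Y → ℝ => Afun p S r x := by
  unfold Afun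
  refine continuous_finsetSum _ fun j _ => ?_
  split_ifs
  · refine continuous_finsetProd _ fun y _ => ?_
    exact (continuous_apply_apply j y).rpow_const fun _ =>
      Or.inr (div_nonneg (hp x y) (hpx x).le)
  · exact continuous_const

lemma Afun_nonneg {r : J → Y → ℝ} (hr : ∀ j y, 0 ≤ r j y) (x : X) : 0 ≤ Afun p S r x := by
  refine sum_nonneg fun j _ => ?_
  split_ifs
  · exact prod_nonneg fun y _ => Real.rpow_nonneg (hr j y) _
  · exact le_rfl

lemma Afun_pos {r : J → Y → ℝ} (hr : ∀ j y, 0 < r j y) {x : X} (hx : ∃ j, x ∈ S j) :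
    0 < Afun p S r x := by
  have hpos : ∀ j, 0 < ∏ y, r j y ^ (p x y / margX p x) :=
    fun j => prod_pos fun y _ => Real.rpow_pos_of_pos (hr j y) _
  obtain ⟨j, hj⟩ := hx
  refine sum_pos' (fun i _ => ?_) ⟨j, mem_univ _, by rw [if_pos hj]; exact hpos j⟩
  split_ifs
  · exact (hpos i).le
  · exact le_rfl

lemma midpoint_mem_Ka [Fintype X] (hp : ∀ x y, 0 ≤ p x y) (hpx : ∀ x, 0 < margX p x)
    {a b : X → ℝ} (ha : a ∈ Ka p S) (hb : b ∈ Ka p S) :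
    (fun x => (a x + b x) / 2) ∈ Ka p S := by
  obtain ⟨r, hr, har⟩ := ha
  obtain ⟨s, hs, hbs⟩ := hb
  refine ⟨_, midpoint_mem_Kr hr hs, fun x => ?_⟩
  have h := Afun_midpoint (S := S) hp hpx hr.1 hs.1 x
  obtain ⟨_, _⟩ := har x
  obtain ⟨_, _⟩ := hbs x
  constructor <;> linarith

end Corner

section Objective

variable [Fintype X] [Fintype Y] {p : X → Y → ℝ}

lemma phiA_of_pos {a : X → ℝ} (ha : ∀ x, 0 < a x) :
    phiA p a = ((-∑ x, margX p x * Real.log (a x) : ℝ) : EReal) :=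
  if_neg fun ⟨x, hx⟩ => (ha x).ne' hx

lemma ne_zero_of_phiA_ne_top {a : X → ℝ} (ha : phiA p a ≠ ⊤) (x : X) : a x ≠ 0 :=
  fun hx => ha (if_pos ⟨x, hx⟩)

/-- Strict midpoint convexity of the objective on the positive orthant. -/
lemma sum_log_midpoint_lt (hpx : ∀ x, 0 < margX p x) {a b : X → ℝ}
    (ha : ∀ x, 0 < a x) (hb : ∀ x, 0 < b x) (hab : a ≠ b) :
    (∑ x, margX p x * Real.log (a x)) + ∑ x, margX p x * Real.log (b x) <
      2 * ∑ x, margX p x * Real.log ((a x + b x) / 2) := by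
  have hlt : ∀ x, a x ≠ b x →
      Real.log (a x) + Real.log (b x) < 2 * Real.log ((a x + b x) / 2) := by
    intro x hx
    have h := strictConcaveOn_log_Ioi.2 (ha x) (hb x) hx (one_half_pos (α := ℝ))
      one_half_pos (add_halves 1)
    simp only [smul_eq_mul] at h
    rw [show (a x + b x) / 2 = 1 / 2 * a x + 1 / 2 * b x by ring]
    linarith
  obtain ⟨x₀, hx₀⟩ := Function.ne_iff.mp hab
  rw [← sum_add_distrib, mul_sum]
  refine sum_lt_sum (fun x _ => ?_) ⟨x₀, mem_univ _, ?_⟩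
  · rw [← mul_add, mul_left_comm]
    refine mul_le_mul_of_nonneg_left ?_ (hpx x).le
    by_cases hx : a x = b x
    · rw [hx, add_self_div_two, two_mul]
    · exact (hlt x hx).le
  · rw [← mul_add, mul_left_comm]
    exact mul_lt_mul_of_pos_left (hlt x₀ hx₀) (hpx x₀)

lemma log_prod_rpow_margX {a : X → ℝ} (ha : ∀ x, 0 < a x) :
    Real.log (∏ x, a x ^ margX p x) = ∑ x, margX p x * Real.log (a x) := by
  rw [Real.log_prod fun x _ => (Real.rpow_pos_of_pos (ha x) _).ne']
  exact sum_congr rfl fun x _ => Real.log_rpow (ha x) _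

/-- Some `r ∈ K_r` has all `A_x(r)` positive and maximizes `∏_x A_x(r)^{p_x}`. -/
lemma exists_maximizer_prod_Afun [Fintype J] [Nonempty J] [DecidableEq X] {S : J → Finset X}
    (hp : ∀ x y, 0 ≤ p x y) (hpx : ∀ x, 0 < margX p x) (hcov : ∀ x, ∃ j, x ∈ S j) :
    ∃ r ∈ Kr J Y, (∀ x, 0 < Afun p S r x) ∧ ∀ s ∈ Kr J Y,
      ∏ x, Afun p S s x ^ margX p x ≤ ∏ x, Afun p S r x ^ margX p x := by
  have hcont : Continuous fun r : J → Y → ℝ => ∏ x, Afun p S r x ^ margX p x :=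
    continuous_finsetProd _ fun x _ =>
      (continuous_Afun hp hpx x).rpow_const fun _ => Or.inr (hpx x).le
  obtain ⟨r, hr, hmax⟩ := isCompact_Kr.exists_isMaxOn ⟨_, uniform_mem_Kr⟩ hcont.continuousOn
  refine ⟨r, hr, fun x => (Afun_nonneg hr.1 x).lt_of_ne' fun hx => ?_, fun s hs => hmax hs⟩
  have hle := hmax (uniform_mem_Kr (J := J) (Y := Y))
  have hpos : 0 < ∏ x, Afun p S (fun _ _ => (Fintype.card J : ℝ)⁻¹) x ^ margX p x :=
    prod_pos fun x _ => Real.rpow_pos_of_pos (Afun_pos (fun _ _ => by positivity) (hcov x)) _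
  have hzero : ∏ x, Afun p S r x ^ margX p x = 0 :=
    prod_eq_zero (mem_univ x) (by rw [hx, Real.zero_rpow (hpx x).ne'])
  exact absurd (hpos.trans_le hle) (by simp only [hzero]; exact lt_irrefl _)

end Objective

/-- there is a unique point of `K_a` minimizing `a ↦ −∑_x p_x log a_x`
over `K_a` (with the convention `−log 0 = +∞`). -/
theorem unique_minimizer_on_Ka (X Y J : Type*) [Fintype X] [Fintype Y] [Fintype J]
    [Nonempty X] [Nonempty Y] [DecidableEq X]
    (p : X → Y → ℝ) (S : J → Finset X)
    (hp : ∀ x y, 0 ≤ p x y) (hptot : ∑ x, ∑ y, p x y = 1)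
    (hpx : ∀ x, 0 < margX p x) (hpy : ∀ y, 0 < margY p y)
    (hcov : ∀ x, ∃ j, x ∈ S j) :
    ∃! a0 : X → ℝ, a0 ∈ Ka p S ∧ ∀ a ∈ Ka p S, phiA p a0 ≤ phiA p a := by
  obtain ⟨j₀, _⟩ := hcov (Classical.arbitrary X)
  have : Nonempty J := ⟨j₀⟩
  obtain ⟨r, hr, hrpos, hmax⟩ := exists_maximizer_prod_Afun hp hpx hcov
  have hpos : ∀ a ∈ Ka p S, phiA p a ≠ ⊤ → ∀ x, 0 < a x := by
    rintro a ⟨s, _, has⟩ htop x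
    exact (has x).1.lt_of_ne' (ne_zero_of_phiA_ne_top htop x)
  have hmem : Afun p S r ∈ Ka p S := ⟨r, hr, fun x => ⟨(hrpos x).le, le_rfl⟩⟩
  have hmin : ∀ a ∈ Ka p S, phiA p (Afun p S r) ≤ phiA p a := by
    intro a ha
    by_cases htop : phiA p a = ⊤
    · rw [htop]
      exact le_top
    have hapos := hpos a ha htop
    obtain ⟨s, hs, has⟩ := ha
    rw [phiA_of_pos hrpos, phiA_of_pos hapos, EReal.coe_le_coe_iff, neg_le_neg_iff,
      ← log_prod_rpow_margX hapos, ← log_prod_rpow_margX hrpos]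
    refine Real.log_le_log (prod_pos fun x _ => Real.rpow_pos_of_pos (hapos x) _)
      (le_trans ?_ (hmax s hs))
    exact prod_le_prod (fun x _ => Real.rpow_nonneg (has x).1 _) fun x _ =>
      Real.rpow_le_rpow (has x).1 (has x).2 (hpx x).le
  refine ⟨Afun p S r, ⟨hmem, hmin⟩, ?_⟩
  rintro b ⟨hb, hbmin⟩
  by_contra hne
  have hb_le := hbmin _ hmem
  have hbpos : ∀ x, 0 < b x := by
    refine hpos b hb fun htop => ?_
    rw [htop, phiA_of_pos hrpos] at hb_le
    exact absurd hb_le (not_le.mpr (EReal.coe_lt_top _))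
  have hmid := hmin _ (midpoint_mem_Ka hp hpx hb hmem)
  have hmidpos : ∀ x, 0 < (b x + Afun p S r x) / 2 :=
    fun x => half_pos (add_pos (hbpos x) (hrpos x))
  rw [phiA_of_pos hrpos, phiA_of_pos hmidpos, EReal.coe_le_coe_iff] at hmid
  rw [phiA_of_pos hrpos, phiA_of_pos hbpos, EReal.coe_le_coe_iff] at hb_le
  have hlt := sum_log_midpoint_lt hpx hbpos hrpos hne
  linarith
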